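/- Let Ω ⊆ ℝ^N be open and let u ∈ 𝒦(Ω) satisfy u ≥ 0 a.e. in Ω and the weak supersolution property: ∫_{ℝ^N}∫_{ℝ^N} (u(x)−u(y))(φ(x)−φ(y))/|x−y|^{N+2s} dx dy ≥ 0 for every nonnegative φ ∈ C^∞_c(Ω). Then either u = 0 a.e. in Ω or u > 0 a.e. in Ω. -/

import Mathlib

open MeasureTheory Filter Topology
open scoped ENNReal RealInnerProductSpace

noncomputable section

abbrev Euc (N : ℕ) := EuclideanSpace ℝ (Fin N)

/-- Gagliardo energy `[u]_s²`. -/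
def gagliardo (N : ℕ) (s : ℝ) (u : Euc N → ℝ) : ℝ≥0∞ :=
  ∫⁻ x : Euc N, ∫⁻ y : Euc N, ENNReal.ofReal ((u x - u y) ^ 2 / ‖x - y‖ ^ ((N : ℝ) + 2 * s))

/-- membership in the concrete model of `𝒟^{s,2}_0(Ω)`. -/
def memK (N : ℕ) (s : ℝ) (Ω : Set (Euc N)) (u : Euc N → ℝ) : Prop :=
  Measurable u ∧ (∀ᵐ x : Euc N ∂volume, x ∉ Ω → u x = 0) ∧ gagliardo N s u < ⊤

/-- first `q`-semilinear `s`-eigenvalue. -/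
def lambda1 (N : ℕ) (s q : ℝ) (Ω : Set (Euc N)) : ℝ≥0∞ :=
  ⨅ u ∈ {u : Euc N → ℝ | memK N s Ω u ∧ (∫ x in Ω, |u x| ^ q) = 1}, gagliardo N s u

/-- nonlocal bilinear form. -/
def dform (N : ℕ) (s : ℝ) (u φ : Euc N → ℝ) : ℝ :=
  ∫ p : Euc N × Euc N, (u p.1 - u p.2) * (φ p.1 - φ p.2) / ‖p.1 - p.2‖ ^ ((N : ℝ) + 2 * s)

/-- compactness of the embedding `𝒦(Ω) ↪ L^q(Ω)`. -/
def compactEmbed (N : ℕ) (s q : ℝ) (Ω : Set (Euc N)) : Prop :=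
  ∀ u : ℕ → Euc N → ℝ, (∀ n, memK N s Ω (u n)) →
    (∃ C : ℝ≥0∞, C < ⊤ ∧ ∀ n, gagliardo N s (u n) ≤ C) →
    ∃ (σ : ℕ → ℕ) (v : Euc N → ℝ), StrictMono σ ∧
      Tendsto (fun k => ∫ x in Ω, |u (σ k) x - v x| ^ q) atTop (𝓝 0)

/-- `q`-semilinear `s`-eigenfunction with eigenvalue `lam`. -/
def isEigenfunction (N : ℕ) (s q : ℝ) (Ω : Set (Euc N)) (lam : ℝ) (u : Euc N → ℝ) : Prop :=
  memK N s Ω u ∧ 0 < ∫ x in Ω, |u x| ^ q ∧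
  ∀ φ : Euc N → ℝ, memK N s Ω φ →
    dform N s u φ
      = lam * (∫ x in Ω, |u x| ^ q) ^ ((2 - q) / q) * ∫ x in Ω, |u x| ^ (q - 2) * u x * φ x

/-- `q`-semilinear `s`-eigenvalue. -/
def isEigenvalue (N : ℕ) (s q : ℝ) (Ω : Set (Euc N)) (lam : ℝ) : Prop :=
  0 < lam ∧ ∃ u : Euc N → ℝ, isEigenfunction N s q Ω lam u

/-- free energy functional `J_Ω`. -/
def freeEnergy (N : ℕ) (s q : ℝ) (Ω : Set (Euc N)) (φ : Euc N → ℝ) : ℝ :=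
  (1 / 2) * (gagliardo N s φ).toReal - (1 / q) * ∫ x in Ω, φ x ^ q

/-- Lane–Emden density of `Ω`: minimizer of the free energy among nonnegative members of `𝒦(Ω)`. -/
def isLaneEmden (N : ℕ) (s q : ℝ) (Ω : Set (Euc N)) (w : Euc N → ℝ) : Prop :=
  memK N s Ω w ∧ (∀ᵐ x : Euc N ∂volume, 0 ≤ w x) ∧
  ∀ φ : Euc N → ℝ, memK N s Ω φ → (∀ᵐ x : Euc N ∂volume, 0 ≤ φ x) →
    freeEnergy N s q Ω w ≤ freeEnergy N s q Ω φ

/-- weak solution of the fractional Lane–Emden equation in `Ω`. -/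
def isWeakSolutionLE (N : ℕ) (s q : ℝ) (Ω : Set (Euc N)) (u : Euc N → ℝ) : Prop :=
  memK N s Ω u ∧ ∀ φ : Euc N → ℝ, memK N s Ω φ →
    dform N s u φ = ∫ x in Ω, |u x| ^ (q - 2) * u x * φ x

/-- nonlocal tail. -/
def nlTail (N : ℕ) (s : ℝ) (w : Euc N → ℝ) (x₀ : Euc N) (ρ : ℝ) : ℝ :=
  ρ ^ (2 * s) * ∫ x in (Metric.ball x₀ ρ)ᶜ, |w x| / ‖x - x₀‖ ^ ((N : ℝ) + 2 * s)

/-- The difference quotient whose square is the integrand of the Gagliardo energy. -/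
def gagliardoQuotient (N : ℕ) (s : ℝ) (u : Euc N → ℝ) (p : Euc N × Euc N) : ℝ :=
  (u p.1 - u p.2) / ‖p.1 - p.2‖ ^ (((N : ℝ) + 2 * s) / 2)

lemma rpow_half_mul_self {a : ℝ} (ha : 0 ≤ a) (r : ℝ) : a ^ (r / 2) * a ^ (r / 2) = a ^ r := by
  rw [← sq, ← Real.rpow_mul_natCast ha]
  norm_num

lemma gagliardoQuotient_mul (N : ℕ) (s : ℝ) (u φ : Euc N → ℝ) (p : Euc N × Euc N) :
    gagliardoQuotient N s u p * gagliardoQuotient N s φ p =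
      (u p.1 - u p.2) * (φ p.1 - φ p.2) / ‖p.1 - p.2‖ ^ ((N : ℝ) + 2 * s) := by
  rw [gagliardoQuotient, gagliardoQuotient, div_mul_div_comm, rpow_half_mul_self (norm_nonneg _)]

lemma dform_eq_integral_gagliardoQuotient (N : ℕ) (s : ℝ) (u φ : Euc N → ℝ) :
    dform N s u φ = ∫ p, gagliardoQuotient N s u p * gagliardoQuotient N s φ p := by
  simp only [gagliardoQuotient_mul, dform]

lemma measurable_gagliardoQuotient {N : ℕ} {s : ℝ} {u : Euc N → ℝ} (hu : Measurable u) :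
    Measurable (gagliardoQuotient N s u) := by
  unfold gagliardoQuotient
  fun_prop

lemma memLp_gagliardoQuotient {N : ℕ} {s : ℝ} {u : Euc N → ℝ} (hu : Measurable u)
    (h : gagliardo N s u < ⊤) : MemLp (gagliardoQuotient N s u) 2 := by
  have hm := measurable_gagliardoQuotient (s := s) hu
  rw [memLp_two_iff_integrable_sq hm.aestronglyMeasurable]
  refine ⟨(hm.pow_const 2).aestronglyMeasurable, ?_⟩
  rw [hasFiniteIntegral_iff_ofReal (Eventually.of_forall fun p => sq_nonneg _)]
  refine lt_of_eq_of_lt ?_ h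
  rw [gagliardo, Measure.volume_eq_prod, lintegral_prod _ (by fun_prop)]
  simp only [sq, gagliardoQuotient_mul]

lemma gagliardoQuotient_sub_diag (N : ℕ) (s : ℝ) (φ : Euc N → ℝ) (p : Euc N × Euc N) (t : Euc N) :
    gagliardoQuotient N s φ (p - (t, t)) =
      (φ (p.1 - t) - φ (p.2 - t)) / ‖p.1 - p.2‖ ^ (((N : ℝ) + 2 * s) / 2) := by
  simp [gagliardoQuotient]

lemma gagliardoQuotient_convolution {N : ℕ} (s : ℝ) {ρ φ : Euc N → ℝ} (hρ : Continuous ρ)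
    (hρc : HasCompactSupport ρ) (hφ : LocallyIntegrable φ) (p : Euc N × Euc N) :
    gagliardoQuotient N s (convolution ρ φ (ContinuousLinearMap.lsmul ℝ ℝ) volume) p =
      ∫ t, ρ t * gagliardoQuotient N s φ (p - (t, t)) := by
  have hex := hρc.convolutionExists_left (ContinuousLinearMap.lsmul ℝ ℝ) hρ hφ
  have h1 := (hex p.1).integrable
  have h2 := (hex p.2).integrable
  simp only [ContinuousLinearMap.lsmul_apply, smul_eq_mul] at h1 h2
  simp only [gagliardoQuotient_sub_diag]
  rw [gagliardoQuotient, convolution_def, convolution_def]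
  simp only [ContinuousLinearMap.lsmul_apply, smul_eq_mul]
  rw [← integral_sub h1 h2, ← integral_div]
  congr 1 with t
  ring

/-- Integrating against translates of a square-integrable function is continuous. -/
lemma continuous_integral_mul_sub {G : Type*} [NormedAddCommGroup G] [NormedSpace ℝ G]
    [FiniteDimensional ℝ G] [MeasurableSpace G] [BorelSpace G] (μ : Measure G)
    [μ.IsAddHaarMeasure] {f g : G → ℝ} (hf : MemLp f 2 μ) (hg : MemLp g 2 μ) :
    Continuous fun t => ∫ p, f p * g (p - t) ∂μ := by
  have : ProperSpace G := FiniteDimensional.proper ℝ G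
  have hfact : Fact ((2 : ℝ≥0∞) ≠ ⊤) := ⟨by simp⟩
  have key : ∀ t : G, ∫ p, f p * g (p - t) ∂μ =
      inner ℝ (hf.toLp f) (DomAddAct.mk (-t) +ᵥ hg.toLp g) := by
    intro t
    rw [L2.inner_def, DomAddAct.mk_vadd_toLp]
    refine integral_congr_ae ?_
    filter_upwards [hf.coeFn_toLp, (hg.comp_measurePreserving
      (measurePreserving_vadd (-t) μ)).coeFn_toLp] with p h1 h2
    refine Eq.trans ?_ (congrArg₂ (inner ℝ) h1 h2).symm
    simp [mul_comm, sub_eq_neg_add]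
  simp only [key]
  have hc : Continuous fun t : G => DomAddAct.mk (-t) +ᵥ hg.toLp g :=
    (DomAddAct.continuous_mk.comp continuous_neg).vadd continuous_const
  exact continuous_const.inner hc

lemma integrable_mul_mul_gagliardoQuotient {N : ℕ} {s : ℝ} {ρ u φ : Euc N → ℝ}
    (hρ : Measurable ρ) (hρi : Integrable ρ) (hu : Measurable u) (hφ : Measurable φ)
    (hU : MemLp (gagliardoQuotient N s u) 2) (hF : MemLp (gagliardoQuotient N s φ) 2) :
    Integrable fun q : Euc N × (Euc N × Euc N) =>
      ρ q.1 * (gagliardoQuotient N s u q.2 * gagliardoQuotient N s φ (q.2 - (q.1, q.1))) := by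
  have hmu := measurable_gagliardoQuotient (s := s) hu
  have hmφ := measurable_gagliardoQuotient (s := s) hφ
  have hmeas : Measurable fun q : Euc N × (Euc N × Euc N) =>
      ρ q.1 * (gagliardoQuotient N s u q.2 * gagliardoQuotient N s φ (q.2 - (q.1, q.1))) := by
    fun_prop
  have : (volume : Measure (Euc N × Euc N)).IsAddHaarMeasure :=
    inferInstanceAs ((volume : Measure (Euc N)).prod volume).IsAddHaarMeasure
  have hFt : ∀ t : Euc N, MemLp (fun p => gagliardoQuotient N s φ (p - (t, t))) 2 := fun t =>
    hF.comp_measurePreserving (measurePreserving_sub_right volume (t, t))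
  rw [Measure.volume_eq_prod, integrable_prod_iff hmeas.aestronglyMeasurable]
  have hUF : ∀ t : Euc N, Integrable fun p =>
      gagliardoQuotient N s u p * gagliardoQuotient N s φ (p - (t, t)) := fun t =>
    hU.integrable_mul (hFt t)
  refine ⟨Eventually.of_forall fun t => (hUF t).const_mul (ρ t), ?_⟩
  refine Integrable.mono' (hρi.norm.mul_const
    ((∫ p, gagliardoQuotient N s u p ^ 2) + ∫ p, gagliardoQuotient N s φ p ^ 2))
    hmeas.aestronglyMeasurable.norm.integral_prod_right' (Eventually.of_forall fun t => ?_)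
  rw [Real.norm_of_nonneg (integral_nonneg fun _ => norm_nonneg _)]
  simp only [norm_mul (ρ _)]
  rw [integral_const_mul]
  refine mul_le_mul_of_nonneg_left ?_ (norm_nonneg _)
  rw [← integral_sub_right_eq_self (fun p => gagliardoQuotient N s φ p ^ 2) (t, t),
    ← integral_add hU.integrable_sq (hFt t).integrable_sq]
  refine integral_mono (hUF t).norm (hU.integrable_sq.add (hFt t).integrable_sq) fun p => ?_
  simp only [norm_mul, Real.norm_eq_abs]
  rw [← sq_abs (gagliardoQuotient N s u p), ← sq_abs (gagliardoQuotient N s φ (p - (t, t)))]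
  nlinarith [sq_nonneg (|gagliardoQuotient N s u p| - |gagliardoQuotient N s φ (p - (t, t))|),
    sq_nonneg |gagliardoQuotient N s u p|, sq_nonneg |gagliardoQuotient N s φ (p - (t, t))|]

lemma dform_convolution {N : ℕ} {s : ℝ} {ρ u φ : Euc N → ℝ} (hρ : Continuous ρ)
    (hρc : HasCompactSupport ρ) (hu : Measurable u) (hφ : Measurable φ)
    (hφl : LocallyIntegrable φ) (hU : MemLp (gagliardoQuotient N s u) 2)
    (hF : MemLp (gagliardoQuotient N s φ) 2) :
    dform N s u (convolution ρ φ (ContinuousLinearMap.lsmul ℝ ℝ) volume) =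
      ∫ t, ρ t * ∫ p, gagliardoQuotient N s u p * gagliardoQuotient N s φ (p - (t, t)) := by
  have hint := integrable_mul_mul_gagliardoQuotient hρ.measurable
    (hρ.integrable_of_hasCompactSupport hρc) hu hφ hU hF
  rw [dform_eq_integral_gagliardoQuotient]
  simp only [gagliardoQuotient_convolution s hρ hρc hφl, ← integral_const_mul]
  rw [integral_integral_swap (f := fun p t => gagliardoQuotient N s u p *
    (ρ t * gagliardoQuotient N s φ (p - (t, t))))]
  · simp only [mul_left_comm]
  · refine hint.swap.congr (Eventually.of_forall fun q => ?_)
    simp [Function.uncurry, mul_left_comm]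

/-- A weak supersolution may be tested against non-smooth functions of finite energy. -/
lemma dform_nonneg_of_supersolution {N : ℕ} {s : ℝ} {Ω : Set (Euc N)} (hΩ : IsOpen Ω)
    {u : Euc N → ℝ} (hu : Measurable u) (hU : MemLp (gagliardoQuotient N s u) 2)
    (hsuper : ∀ φ : Euc N → ℝ, ContDiff ℝ (⊤ : ℕ∞) φ → HasCompactSupport φ → tsupport φ ⊆ Ω →
      (∀ x, 0 ≤ φ x) → 0 ≤ dform N s u φ)
    {φ : Euc N → ℝ} (hφ : Measurable φ) (hφl : LocallyIntegrable φ) (hφc : HasCompactSupport φ)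
    (hφΩ : tsupport φ ⊆ Ω) (hφ0 : ∀ x, 0 ≤ φ x) (hF : MemLp (gagliardoQuotient N s φ) 2) :
    0 ≤ dform N s u φ := by
  have : (volume : Measure (Euc N × Euc N)).IsAddHaarMeasure :=
    inferInstanceAs ((volume : Measure (Euc N)).prod volume).IsAddHaarMeasure
  set h : Euc N → ℝ := fun t =>
    ∫ p, gagliardoQuotient N s u p * gagliardoQuotient N s φ (p - (t, t)) with hh
  have hcont : Continuous h :=
    (continuous_integral_mul_sub volume hU hF).comp (continuous_id.prodMk continuous_id)
  have h0 : dform N s u φ = h 0 := by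
    rw [dform_eq_integral_gagliardoQuotient, hh]
    simp [← Prod.zero_eq_mk]
  rw [h0]
  by_contra! hneg
  obtain ⟨r, hr, hrh⟩ := Metric.eventually_nhds_iff_ball.1
    ((hcont.tendsto 0).eventually_lt_const (show h 0 < h 0 / 2 by linarith))
  obtain ⟨δ, hδ, hδΩ⟩ := hφc.isCompact.exists_cthickening_subset_open hΩ hφΩ
  let b : ContDiffBump (0 : Euc N) := ⟨min r δ / 2, min r δ, by positivity,
    half_lt_self (by positivity)⟩
  set ρ := b.normed volume with hρ
  have hρc : HasCompactSupport ρ := b.hasCompactSupport_normed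
  have hρcont : Continuous ρ := b.continuous_normed
  have hsupp : tsupport (convolution ρ φ (ContinuousLinearMap.lsmul ℝ ℝ) volume) ⊆ Ω := by
    refine subset_trans (closure_minimal ?_ Metric.isClosed_cthickening) hδΩ
    refine (support_convolution_subset _).trans ?_
    rintro _ ⟨x, hx, y, hy, rfl⟩
    rw [hρ, b.support_normed_eq, mem_ball_zero_iff] at hx
    refine Metric.mem_cthickening_of_dist_le (x + y) y δ _ (subset_tsupport _ hy) ?_
    simpa using hx.le.trans (min_le_right r δ)
  have hpos := hsuper _ (hρc.contDiff_convolution_left _ b.contDiff_normed hφl)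
    (hρc.convolution _ hφc) hsupp (fun x => by
      rw [convolution_def]
      exact integral_nonneg fun t => mul_nonneg (b.nonneg_normed t) (hφ0 _))
  rw [dform_convolution hρcont hρc hu hφ hφl hU hF] at hpos
  have hle : ∫ t, ρ t * h t ≤ ∫ t, ρ t * (h 0 / 2) := by
    refine integral_mono
      ((hρcont.mul hcont).integrable_of_hasCompactSupport hρc.mul_right)
      (b.integrable_normed.mul_const _) fun t => ?_
    by_cases ht : t ∈ Metric.ball (0 : Euc N) (min r δ)
    · exact mul_le_mul_of_nonneg_left
        (hrh t (Metric.ball_subset_ball (min_le_left r δ) ht)).le (b.nonneg_normed t)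
    · have : ρ t = 0 := by
        rw [← Function.notMem_support, hρ, b.support_normed_eq]
        exact ht
      simp [this]
  rw [integral_mul_const, hρ, b.integral_normed] at hle
  linarith

lemma integrable_min_sq_one_div_rpow {N : ℕ} (hN : 1 ≤ N) {s : ℝ} (hs : s ∈ Set.Ioo (0 : ℝ) 1) :
    Integrable fun z : Euc N => min (‖z‖ ^ 2) 1 / ‖z‖ ^ ((N : ℝ) + 2 * s) := by
  have : Nontrivial (Euc N) := by
    have : Nonempty (Fin N) := ⟨⟨0, hN⟩⟩
    infer_instance
  rw [integrable_fun_norm_addHaar volume (f := fun r => min (r ^ 2) 1 / r ^ ((N : ℝ) + 2 * s))]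
  have hpow : ∀ y : ℝ, 0 < y → y ^ (N - 1) / y ^ ((N : ℝ) + 2 * s) = y ^ (-1 - 2 * s) := by
    intro y hy
    rw [← Real.rpow_natCast, ← Real.rpow_sub hy, Nat.cast_sub hN]
    congr 1
    push_cast
    ring
  simp only [finrank_euclideanSpace, Fintype.card_fin, smul_eq_mul]
  rw [← Set.Ioc_union_Ioi_eq_Ioi zero_le_one]
  refine IntegrableOn.union ?_ ?_
  · have h1 : IntegrableOn (fun y : ℝ => y ^ (1 - 2 * s)) (Set.Ioc 0 1) :=
      (intervalIntegrable_iff_integrableOn_Ioc_of_le zero_le_one).1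
        (intervalIntegral.intervalIntegrable_rpow' (by linarith [hs.2]))
    refine h1.congr_fun (fun y hy => ?_) measurableSet_Ioc
    have hy1 : y ^ 2 ≤ 1 := pow_le_one₀ hy.1.le hy.2
    simp only [min_eq_left hy1]
    rw [mul_div_left_comm, hpow y hy.1, ← Real.rpow_natCast, ← Real.rpow_add hy.1]
    congr 1
    push_cast
    ring
  · refine (integrableOn_Ioi_rpow_of_lt (a := -1 - 2 * s) (by linarith [hs.1])
      zero_lt_one).congr_fun (fun y hy => ?_) measurableSet_Ioi
    have hy1 : 1 ≤ y ^ 2 := one_le_pow₀ (le_of_lt hy)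
    simp only [min_eq_right hy1]
    rw [mul_one_div, hpow y (zero_lt_one.trans hy)]

lemma gagliardo_lt_top_of_lipschitz {N : ℕ} (hN : 1 ≤ N) {s : ℝ} (hs : s ∈ Set.Ioo (0 : ℝ) 1)
    {ψ : Euc N → ℝ} {L : NNReal} (hL : LipschitzWith L ψ) (hψc : HasCompactSupport ψ)
    (h0 : ∀ x, 0 ≤ ψ x) (h1 : ∀ x, ψ x ≤ 1) : gagliardo N s ψ < ⊤ := by
  set κ : Euc N → ℝ≥0∞ := fun z =>
    ENNReal.ofReal ((L ^ 2 + 1) * (min (‖z‖ ^ 2) 1 / ‖z‖ ^ ((N : ℝ) + 2 * s))) with hκ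
  have hκm : Measurable κ := by fun_prop
  have hκi : ∫⁻ z, κ z < ⊤ :=
    (hasFiniteIntegral_iff_ofReal (Eventually.of_forall fun z => by positivity)).1
      ((integrable_min_sq_one_div_rpow hN hs).const_mul _).hasFiniteIntegral
  set K := tsupport ψ
  have hKm : MeasurableSet K := (isClosed_tsupport ψ).measurableSet
  set χ : Euc N → ℝ≥0∞ := K.indicator 1 with hχ
  have hχm : Measurable χ := measurable_one.indicator hKm
  have hχi : ∫⁻ x, χ x < ⊤ := by
    rw [hχ, lintegral_indicator_one hKm]
    exact hψc.isCompact.measure_lt_top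
  have hbound : ∀ x y, ENNReal.ofReal ((ψ x - ψ y) ^ 2 / ‖x - y‖ ^ ((N : ℝ) + 2 * s)) ≤
      χ x * κ (x - y) + χ y * κ (x - y) := by
    intro x y
    by_cases hxy : x ∈ K ∨ y ∈ K
    · have hκle : ENNReal.ofReal ((ψ x - ψ y) ^ 2 / ‖x - y‖ ^ ((N : ℝ) + 2 * s)) ≤ κ (x - y) := by
        refine ENNReal.ofReal_le_ofReal ?_
        rw [← mul_div_assoc]
        refine div_le_div_of_nonneg_right ?_ (by positivity)
        have hd : |ψ x - ψ y| ≤ L * ‖x - y‖ := by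
          simpa [Real.dist_eq, dist_eq_norm] using hL.dist_le_mul x y
        have hd1 : |ψ x - ψ y| ≤ 1 := by
          rw [abs_le]; constructor <;> linarith [h0 x, h0 y, h1 x, h1 y]
        rcases min_cases (‖x - y‖ ^ 2) 1 with ⟨h, -⟩ | ⟨h, -⟩ <;> rw [h, ← sq_abs]
        · calc |ψ x - ψ y| ^ 2 ≤ (L * ‖x - y‖) ^ 2 := by gcongr
            _ ≤ _ := by nlinarith [sq_nonneg ‖x - y‖]
        · calc |ψ x - ψ y| ^ 2 ≤ 1 ^ 2 := by gcongr
            _ ≤ _ := by nlinarith [sq_nonneg (L : ℝ)]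
      refine hκle.trans ?_
      rcases hxy with h | h <;> simp [hχ, h]
    · push Not at hxy
      simp [image_eq_zero_of_notMem_tsupport hxy.1, image_eq_zero_of_notMem_tsupport hxy.2]
  have hfst : ∫⁻ x, ∫⁻ y, χ x * κ (x - y) = (∫⁻ x, χ x) * ∫⁻ z, κ z := by
    rw [← lintegral_mul_const _ hχm]
    refine lintegral_congr fun x => ?_
    rw [lintegral_const_mul _ (by fun_prop), lintegral_sub_left_eq_self κ]
  have hsnd : ∫⁻ x, ∫⁻ y, χ y * κ (x - y) = (∫⁻ x, χ x) * ∫⁻ z, κ z := by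
    rw [lintegral_lintegral_swap (by fun_prop), ← lintegral_mul_const _ hχm]
    refine lintegral_congr fun y => ?_
    rw [lintegral_const_mul _ (by fun_prop), lintegral_sub_right_eq_self κ]
  calc gagliardo N s ψ ≤ ∫⁻ x, ∫⁻ y, (χ x * κ (x - y) + χ y * κ (x - y)) :=
        lintegral_mono fun x => lintegral_mono fun y => hbound x y
    _ = (∫⁻ x, χ x) * (∫⁻ z, κ z) + (∫⁻ x, χ x) * ∫⁻ z, κ z := by
        nth_rw 1 [← hfst]
        rw [← hsnd, ← lintegral_add_left (by fun_prop)]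
        exact lintegral_congr fun x => lintegral_add_left (by fun_prop) _
    _ < ⊤ := by
        have := ENNReal.mul_lt_top hχi hκi
        exact ENNReal.add_lt_top.2 ⟨this, this⟩

/-- Piecewise linear nonincreasing cutoffs decreasing to the indicator of the nonpositive reals. -/
def lowCutoff (n : ℕ) (t : ℝ) : ℝ := max 0 (1 - (n + 1) * max t 0)

lemma lowCutoff_nonneg (n : ℕ) (t : ℝ) : 0 ≤ lowCutoff n t := le_max_left _ _

lemma lowCutoff_le_one (n : ℕ) (t : ℝ) : lowCutoff n t ≤ 1 :=
  max_le zero_le_one <| sub_le_self _ <| mul_nonneg (by positivity) (le_max_right t 0)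

lemma lowCutoff_antitone (n : ℕ) : Antitone (lowCutoff n) := fun a b hab => by
  unfold lowCutoff
  gcongr

lemma continuous_lowCutoff (n : ℕ) : Continuous (lowCutoff n) := by
  unfold lowCutoff
  fun_prop

lemma abs_lowCutoff_sub_le (n : ℕ) (a b : ℝ) :
    |lowCutoff n a - lowCutoff n b| ≤ (n + 1) * |a - b| := by
  have hn : (0 : ℝ) ≤ n + 1 := by positivity
  calc |lowCutoff n a - lowCutoff n b|
      ≤ |(1 - (n + 1) * max a 0) - (1 - (n + 1) * max b 0)| := by
        simpa [lowCutoff, max_comm] using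
          abs_max_sub_max_le_abs (1 - (n + 1) * max a 0) (1 - (n + 1) * max b 0) 0
    _ = (n + 1) * |max a 0 - max b 0| := by
        rw [sub_sub_sub_cancel_left, ← mul_sub, abs_mul, abs_of_nonneg hn, abs_sub_comm]
    _ ≤ (n + 1) * |a - b| :=
        mul_le_mul_of_nonneg_left (abs_max_sub_max_le_abs a b 0) hn

lemma tendsto_lowCutoff (t : ℝ) :
    Tendsto (fun n => lowCutoff n t) atTop (𝓝 (Set.indicator (Set.Iic 0) 1 t)) := by
  by_cases ht : t ≤ 0
  · simp [lowCutoff, ht]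
  · push Not at ht
    have hlim : Tendsto (fun n : ℕ => ((n : ℝ) + 1) * t) atTop atTop :=
      (tendsto_atTop_add_const_right _ _ tendsto_natCast_atTop_atTop).atTop_mul_const ht
    rw [Set.indicator_of_notMem (by simpa using ht)]
    refine tendsto_const_nhds.congr' ?_
    filter_upwards [hlim.eventually_ge_atTop 1] with n hn
    rw [lowCutoff, max_eq_left ht.le, max_eq_left (by linarith)]

lemma memLp_gagliardoQuotient_mul_lowCutoff {N : ℕ} {s : ℝ} {u ψ : Euc N → ℝ}
    (hu : Measurable u) (hψ : Measurable ψ) (h0 : ∀ x, 0 ≤ ψ x) (h1 : ∀ x, ψ x ≤ 1)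
    (hU : MemLp (gagliardoQuotient N s u) 2) (hP : MemLp (gagliardoQuotient N s ψ) 2) (n : ℕ) :
    MemLp (gagliardoQuotient N s fun x => ψ x * lowCutoff n (u x)) 2 := by
  have hm : Measurable fun x => ψ x * lowCutoff n (u x) :=
    hψ.mul ((continuous_lowCutoff n).measurable.comp hu)
  refine MemLp.of_le ((hU.norm.const_mul ((n : ℝ) + 1)).add hP.norm)
    (measurable_gagliardoQuotient hm).aestronglyMeasurable (Eventually.of_forall fun p => ?_)
  refine le_trans ?_ (le_abs_self _)
  simp only [gagliardoQuotient, norm_div, Pi.add_apply, ← mul_div_assoc, ← add_div]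
  refine div_le_div_of_nonneg_right ?_ (norm_nonneg _)
  simp only [Real.norm_eq_abs]
  calc |ψ p.1 * lowCutoff n (u p.1) - ψ p.2 * lowCutoff n (u p.2)|
      = |ψ p.1 * (lowCutoff n (u p.1) - lowCutoff n (u p.2)) +
          (ψ p.1 - ψ p.2) * lowCutoff n (u p.2)| := by ring_nf
    _ ≤ ψ p.1 * |lowCutoff n (u p.1) - lowCutoff n (u p.2)| +
          |ψ p.1 - ψ p.2| * lowCutoff n (u p.2) := by
        refine (abs_add_le _ _).trans_eq ?_
        rw [abs_mul, abs_mul, abs_of_nonneg (h0 _), abs_of_nonneg (lowCutoff_nonneg _ _)]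
    _ ≤ 1 * ((n + 1) * |u p.1 - u p.2|) + |ψ p.1 - ψ p.2| * 1 := by
        gcongr
        · exact h1 _
        · exact abs_lowCutoff_sub_le n _ _
        · exact lowCutoff_le_one n _
    _ = _ := by ring

/-- The energy density of `u` against `ψ · g(u)` with `g` nonincreasing and `0 ≤ g ≤ 1` is bounded
above independently of `g`. -/
lemma sub_mul_mul_sub_mul_le {a b ga gb p q : ℝ} (h : (a - b) * (ga - gb) ≤ 0) (hp : 0 ≤ p)
    (hgb : 0 ≤ gb) (hgb1 : gb ≤ 1) : (a - b) * (p * ga - q * gb) ≤ |a - b| * |p - q| := by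
  have h1 : (a - b) * (p - q) ≤ |a - b| * |p - q| := by
    rw [← abs_mul]; exact le_abs_self _
  nlinarith [mul_nonneg (abs_nonneg (a - b)) (abs_nonneg (p - q)), mul_nonneg hp (neg_nonneg.2 h),
    mul_le_mul_of_nonneg_right h1 hgb, mul_nonneg (mul_nonneg (abs_nonneg (a - b))
    (abs_nonneg (p - q))) (sub_nonneg.2 hgb1)]

/-- In a Fatou limit of integrals bounded above by a common integrable function, nonnegativity of
the integrals forces a nonpositive pointwise limit to vanish. -/
lemma ae_eq_zero_of_tendsto_of_integral_nonneg {α : Type*} [MeasurableSpace α] {μ : Measure α}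
    {f : ℕ → α → ℝ} {F G : α → ℝ} (hf : ∀ n, Integrable (f n) μ) (hG : Integrable G μ)
    (hle : ∀ n x, f n x ≤ G x) (hlim : ∀ x, Tendsto (fun n => f n x) atTop (𝓝 (F x)))
    (h0 : ∀ n, 0 ≤ ∫ x, f n x ∂μ) (hF : ∀ᵐ x ∂μ, F x ≤ 0) (hG0 : ∀ x, 0 ≤ G x) :
    ∀ᵐ x ∂μ, F x = 0 := by
  have hFm : AEStronglyMeasurable F μ :=
    aestronglyMeasurable_of_tendsto_ae atTop (fun n => (hf n).aestronglyMeasurable)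
      (Eventually.of_forall hlim)
  have hfatou : ∫⁻ x, ENNReal.ofReal (G x - F x) ∂μ ≤ ∫⁻ x, ENNReal.ofReal (G x) ∂μ := by
    calc ∫⁻ x, ENNReal.ofReal (G x - F x) ∂μ
        = ∫⁻ x, liminf (fun n => ENNReal.ofReal (G x - f n x)) atTop ∂μ :=
          lintegral_congr fun x => ((ENNReal.continuous_ofReal.tendsto _).comp
            (tendsto_const_nhds.sub (hlim x))).liminf_eq.symm
      _ ≤ liminf (fun n => ∫⁻ x, ENNReal.ofReal (G x - f n x) ∂μ) atTop :=
          lintegral_liminf_le' fun n =>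
            (hG.aestronglyMeasurable.sub (hf n).aestronglyMeasurable).aemeasurable.ennreal_ofReal
      _ ≤ ∫⁻ x, ENNReal.ofReal (G x) ∂μ := by
          refine liminf_le_of_le (by isBoundedDefault) fun c hc => ?_
          obtain ⟨n, hn⟩ := hc.exists
          refine (hn.trans_eq (ofReal_integral_eq_lintegral_ofReal (hG.sub (hf n))
            (Eventually.of_forall fun x => sub_nonneg.2 (hle n x))).symm).trans ?_
          rw [← ofReal_integral_eq_lintegral_ofReal hG (Eventually.of_forall hG0)]
          refine ENNReal.ofReal_le_ofReal ?_
          rw [integral_sub' hG (hf n)]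
          linarith [h0 n]
  have hGfin : ∫⁻ x, ENNReal.ofReal (G x) ∂μ ≠ ⊤ :=
    ((hasFiniteIntegral_iff_ofReal (Eventually.of_forall hG0)).1 hG.hasFiniteIntegral).ne
  have hae := ae_eq_of_ae_le_of_lintegral_le (f := fun x => ENNReal.ofReal (G x))
    (g := fun x => ENNReal.ofReal (G x - F x))
    (hF.mono fun x hx => ENNReal.ofReal_le_ofReal (by linarith)) hGfin
    (hG.aestronglyMeasurable.sub hFm).aemeasurable.ennreal_ofReal hfatou
  filter_upwards [hae, hF] with x hx hx0
  rw [ENNReal.ofReal_eq_ofReal_iff (hG0 x) (by linarith [hG0 x])] at hx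
  linarith

/-- strong minimum principle for nonnegative weak supersolutions. -/
theorem stmt_19 (N : ℕ) (hN : 1 ≤ N) (s : ℝ) (hs : s ∈ Set.Ioo (0 : ℝ) 1)
    (Ω : Set (Euc N)) (hΩ : IsOpen Ω)
    (u : Euc N → ℝ) (hu : memK N s Ω u)
    (hnn : ∀ᵐ x ∂volume.restrict Ω, 0 ≤ u x)
    (hsuper : ∀ φ : Euc N → ℝ, ContDiff ℝ (⊤ : ℕ∞) φ → HasCompactSupport φ → tsupport φ ⊆ Ω →
      (∀ x, 0 ≤ φ x) → 0 ≤ dform N s u φ) :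
    (∀ᵐ x ∂volume.restrict Ω, u x = 0) ∨ (∀ᵐ x ∂volume.restrict Ω, 0 < u x) := by
  obtain ⟨hum, huΩ, hue⟩ := hu
  have hu0 : ∀ᵐ x : Euc N, 0 ≤ u x := by
    filter_upwards [huΩ, (ae_restrict_iff' hΩ.measurableSet).1 hnn] with x hx hx'
    by_cases h : x ∈ Ω
    · exact hx' h
    · exact (hx h).ge
  by_cases hzero : volume (Ω ∩ {x | u x ≤ 0}) = 0
  · right
    rw [ae_restrict_iff' hΩ.measurableSet, ae_iff]
    refine measure_mono_null (fun x hx => ?_) hzero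
    simpa using hx
  left
  refine ae_restrict_of_ae ?_
  obtain ⟨x₀, hx₀, hpos⟩ := exists_mem_forall_mem_nhdsWithin_pos_measure hzero
  obtain ⟨r, hr, hrΩ⟩ := Metric.isOpen_iff.1 hΩ x₀ hx₀.1
  let ψ : ContDiffBump x₀ := ⟨r / 4, r / 2, by positivity, by linarith⟩
  have hψΩ : tsupport ψ ⊆ Ω := by
    rw [ψ.tsupport_eq]
    exact (Metric.closedBall_subset_ball (half_lt_self hr)).trans hrΩ
  have hψm : Measurable ψ := ψ.continuous.measurable
  obtain ⟨L, hL⟩ := (ψ.contDiff (n := 1)).lipschitzWith_of_hasCompactSupport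
    ψ.hasCompactSupport one_ne_zero
  have hU := memLp_gagliardoQuotient hum hue
  have hP := memLp_gagliardoQuotient hψm
    (gagliardo_lt_top_of_lipschitz hN hs hL ψ.hasCompactSupport ψ.nonneg' fun x => ψ.le_one)
  have hΦ := memLp_gagliardoQuotient_mul_lowCutoff hum hψm ψ.nonneg' (fun x => ψ.le_one) hU hP
  have htest : ∀ n, 0 ≤ dform N s u fun x => ψ x * lowCutoff n (u x) := by
    intro n
    have hm : Measurable fun x => lowCutoff n (u x) := (continuous_lowCutoff n).measurable.comp hum
    refine dform_nonneg_of_supersolution hΩ hum hU hsuper (hψm.mul hm) ?_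
      ψ.hasCompactSupport.mul_right ((tsupport_mul_subset_left).trans hψΩ)
      (fun x => mul_nonneg ψ.nonneg (lowCutoff_nonneg _ _)) (hΦ n)
    refine (ψ.integrable (μ := volume)).locallyIntegrable.mono
      (hψm.mul hm).aestronglyMeasurable (Eventually.of_forall fun x => ?_)
    rw [norm_mul, Real.norm_of_nonneg (lowCutoff_nonneg _ _)]
    exact mul_le_of_le_one_right (norm_nonneg _) (lowCutoff_le_one _ _)
  set k : Euc N × Euc N → ℝ := fun p => ‖p.1 - p.2‖ ^ ((N : ℝ) + 2 * s)
  set χ : ℝ → ℝ := Set.indicator (Set.Iic 0) 1 with hχ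
  have hk : ∀ p, 0 ≤ k p := fun p => by positivity
  have hlim := ae_eq_zero_of_tendsto_of_integral_nonneg (μ := (volume : Measure (Euc N × Euc N)))
    (f := fun n p => (u p.1 - u p.2) *
      (ψ p.1 * lowCutoff n (u p.1) - ψ p.2 * lowCutoff n (u p.2)) / k p)
    (F := fun p => (u p.1 - u p.2) * (ψ p.1 * χ (u p.1) - ψ p.2 * χ (u p.2)) / k p)
    (G := fun p => |u p.1 - u p.2| * |ψ p.1 - ψ p.2| / k p)
    (fun n => by
      have := hU.integrable_mul (hΦ n)
      refine this.congr (Eventually.of_forall fun p => ?_)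
      exact gagliardoQuotient_mul _ _ _ _ _)
    (by
      have := (hU.integrable_mul hP).norm
      refine this.congr (Eventually.of_forall fun p => ?_)
      simp only [Pi.mul_apply]
      rw [gagliardoQuotient_mul, norm_div, norm_mul, Real.norm_of_nonneg (hk p)]
      rfl)
    (fun n p => div_le_div_of_nonneg_right (sub_mul_mul_sub_mul_le (by
      rcases le_total (u p.1) (u p.2) with h | h
      · exact mul_nonpos_of_nonpos_of_nonneg (sub_nonpos.2 h)
          (sub_nonneg.2 (lowCutoff_antitone n h))
      · exact mul_nonpos_of_nonneg_of_nonpos (sub_nonneg.2 h)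
          (sub_nonpos.2 (lowCutoff_antitone n h)))
      ψ.nonneg (lowCutoff_nonneg _ _) (lowCutoff_le_one _ _)) (hk p))
    (fun p => (((tendsto_lowCutoff _).const_mul _).sub
      ((tendsto_lowCutoff _).const_mul _)).const_mul _ |>.div_const _)
    htest
    (by
      have h1 : ∀ᵐ p : Euc N × Euc N, 0 ≤ u p.1 :=
        Measure.quasiMeasurePreserving_fst.ae hu0
      have h2 : ∀ᵐ p : Euc N × Euc N, 0 ≤ u p.2 :=
        Measure.quasiMeasurePreserving_snd.ae hu0
      filter_upwards [h1, h2] with p hp1 hp2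
      refine div_nonpos_of_nonpos_of_nonneg ?_ (hk p)
      have hψ1 := ψ.nonneg (x := p.1)
      have hψ2 := ψ.nonneg (x := p.2)
      by_cases h1 : u p.1 ≤ 0 <;> by_cases h2 : u p.2 ≤ 0
      · simp [le_antisymm h1 hp1, le_antisymm h2 hp2]
      · simp only [hχ, Set.indicator, Set.mem_Iic, h1, h2, if_true, if_false, Pi.one_apply]
        nlinarith
      · simp only [hχ, Set.indicator, Set.mem_Iic, h1, h2, if_true, if_false, Pi.one_apply]
        nlinarith
      · simp [hχ, h1, h2])
    (fun p => div_nonneg (by positivity) (hk p))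
  have hball : volume (Metric.ball x₀ (r / 2) ∩ (Ω ∩ {x | u x ≤ 0})) ≠ 0 :=
    (hpos _ (inter_mem (mem_nhdsWithin_of_mem_nhds (Metric.ball_mem_nhds x₀ (half_pos hr)))
      self_mem_nhdsWithin)).ne'
  obtain ⟨x, ⟨hxball, -, hxu⟩, hx, hx0⟩ :=
    (frequently_ae_mem_iff.2 hball).and_eventually
      ((Measure.ae_ae_of_ae_prod hlim).and hu0) |>.exists
  have hux : u x = 0 := le_antisymm hxu hx0
  have hψx : 0 < ψ x := ψ.pos_of_mem_ball hxball
  have hne : ∀ᵐ y : Euc N, y ≠ x := by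
    have : Nonempty (Fin N) := ⟨⟨0, hN⟩⟩
    exact Measure.ae_ne volume x
  filter_upwards [hx, hu0, hne] with y hy hy0 hyx
  refine le_antisymm ?_ hy0
  by_contra! hpos
  have hkpos : k (x, y) ≠ 0 :=
    (Real.rpow_pos_of_pos (norm_pos_iff.2 (sub_ne_zero.2 hyx.symm)) _).ne'
  simp [hχ, hux, hpos.not_ge, hkpos, hψx.ne', hpos.ne'] at hy
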